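/- arXiv:2011.09029 — 3 statements merged into one kernel-verified Lean document; each statement's English description precedes it below -/
import Mathlib

section
/- Consider the matrix factor model Y = A₁XP₁ᵀ + A₂E₂₁P₁ᵀ + A₁E₁₂P₂ᵀ + A₂E₂₂P₂ᵀ. Suppose B₂ ∈ ℝ^{p₁×r₁} satisfies B₂ᵀA₂ = 0, Q₂ ∈ ℝ^{p₂×r₂} satisfies P₂ᵀQ₂ = 0, and both B₂ᵀA₁ ∈ ℝ^{r₁×r₁} and P₁ᵀQ₂ ∈ ℝ^{r₂×r₂} are invertible. Then B₂ᵀYQ₂ = B₂ᵀA₁XP₁ᵀQ₂, and consequently the latent factor matrix is exactly recovered as X = (B₂ᵀA₁)⁻¹ B₂ᵀ Y Q₂ (P₁ᵀQ₂)⁻¹. -/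
open Matrix

/-- in the matrix factor model, if `B₂ᵀA₂ = 0`, `P₂ᵀQ₂ = 0` and both `B₂ᵀA₁`
and `P₁ᵀQ₂` are invertible, then `B₂ᵀYQ₂ = B₂ᵀA₁XP₁ᵀQ₂` and the latent factor matrix is
exactly recovered as `X = (B₂ᵀA₁)⁻¹ B₂ᵀ Y Q₂ (P₁ᵀQ₂)⁻¹`. -/
theorem exact_factor_recovery
    {p₁ p₂ r₁ r₂ v₁ v₂ : ℕ}
    (A₁ : Matrix (Fin p₁) (Fin r₁) ℝ) (A₂ : Matrix (Fin p₁) (Fin v₁) ℝ)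
    (P₁ : Matrix (Fin p₂) (Fin r₂) ℝ) (P₂ : Matrix (Fin p₂) (Fin v₂) ℝ)
    (X : Matrix (Fin r₁) (Fin r₂) ℝ)
    (E₂₁ : Matrix (Fin v₁) (Fin r₂) ℝ) (E₁₂ : Matrix (Fin r₁) (Fin v₂) ℝ)
    (E₂₂ : Matrix (Fin v₁) (Fin v₂) ℝ)
    (Y : Matrix (Fin p₁) (Fin p₂) ℝ)
    (hY : Y = A₁ * X * P₁ᵀ + A₂ * E₂₁ * P₁ᵀ + A₁ * E₁₂ * P₂ᵀ + A₂ * E₂₂ * P₂ᵀ)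
    (B₂ : Matrix (Fin p₁) (Fin r₁) ℝ) (hB : B₂ᵀ * A₂ = 0)
    (Q₂ : Matrix (Fin p₂) (Fin r₂) ℝ) (hQ : P₂ᵀ * Q₂ = 0)
    (h₁ : IsUnit (B₂ᵀ * A₁)) (h₂ : IsUnit (P₁ᵀ * Q₂)) :
    B₂ᵀ * Y * Q₂ = B₂ᵀ * A₁ * X * (P₁ᵀ * Q₂) ∧
    X = (B₂ᵀ * A₁)⁻¹ * (B₂ᵀ * Y * Q₂) * (P₁ᵀ * Q₂)⁻¹ := by
  have hBY : B₂ᵀ * Y * Q₂ = B₂ᵀ * A₁ * X * (P₁ᵀ * Q₂) := by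
    have hB' {n : ℕ} (M : Matrix (Fin v₁) (Fin n) ℝ) : B₂ᵀ * (A₂ * M) = 0 := by
      rw [← Matrix.mul_assoc, hB, Matrix.zero_mul]
    simp only [hY, Matrix.mul_add, Matrix.add_mul, Matrix.mul_assoc, hQ, hB',
      Matrix.mul_zero, add_zero]
  refine ⟨hBY, ?_⟩
  rw [Matrix.isUnit_iff_isUnit_det] at h₁ h₂
  rw [hBY, Matrix.mul_assoc (B₂ᵀ * A₁), Matrix.nonsing_inv_mul_cancel_left _ _ h₁,
    Matrix.mul_nonsing_inv_cancel_right _ _ h₂]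
end

section
/- For i = 1, 2, let H_i ∈ ℝ^{p×h_i} have full column rank h_i, and let P_i = H_i(H_iᵀH_i)⁻¹H_iᵀ be the orthogonal projection onto the column space of H_i. Then tr(P₁P₂) = min(h₁, h₂) if and only if M(H₁) ⊆ M(H₂) or M(H₂) ⊆ M(H₁); in particular, when h₁ = h₂ the generalized discrepancy D̄(M(H₁), M(H₂)) = √(1 − tr(P₁P₂)/max(h₁,h₂)) equals 0 if and only if one column space is contained in the other. -/
open Matrix

/-- Orthogonal projection onto the column space of `H`: `P = H(HᵀH)⁻¹Hᵀ`. -/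
noncomputable def proj {p h : ℕ} (H : Matrix (Fin p) (Fin h) ℝ) :
    Matrix (Fin p) (Fin p) ℝ :=
  H * (Hᵀ * H)⁻¹ * Hᵀ

theorem isUnit_transpose_mul_self_of_rank_eq {p h : ℕ} {H : Matrix (Fin p) (Fin h) ℝ}
    (hr : H.rank = h) : IsUnit (Hᵀ * H) := by
  rw [← mulVec_surjective_iff_isUnit, ← coe_mulVecLin, ← LinearMap.range_eq_top]
  apply Submodule.eq_top_of_finrank_eq
  change (Hᵀ * H).rank = _
  rw [rank_transpose_mul_self, hr, Module.finrank_fin_fun]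

theorem transpose_proj {p h : ℕ} (H : Matrix (Fin p) (Fin h) ℝ) : (proj H)ᵀ = proj H := by
  simp only [proj, transpose_mul, transpose_transpose, transpose_nonsing_inv, Matrix.mul_assoc]

theorem proj_mul_self {p h : ℕ} {H : Matrix (Fin p) (Fin h) ℝ} (hr : H.rank = h) :
    proj H * H = H := by
  have hu := (isUnit_iff_isUnit_det _).1 (isUnit_transpose_mul_self_of_rank_eq hr)
  rw [proj, Matrix.mul_assoc, Matrix.mul_assoc, nonsing_inv_mul _ hu, Matrix.mul_one]

theorem proj_mul_proj {p h : ℕ} {H : Matrix (Fin p) (Fin h) ℝ} (hr : H.rank = h) :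
    proj H * proj H = proj H := by
  conv_lhs => arg 2; rw [proj]
  rw [← Matrix.mul_assoc, ← Matrix.mul_assoc, proj_mul_self hr, proj]

theorem trace_proj {p h : ℕ} {H : Matrix (Fin p) (Fin h) ℝ} (hr : H.rank = h) :
    (proj H).trace = h := by
  have hu := (isUnit_iff_isUnit_det _).1 (isUnit_transpose_mul_self_of_rank_eq hr)
  rw [proj, trace_mul_comm, ← Matrix.mul_assoc, mul_nonsing_inv _ hu, trace_one, Fintype.card_fin]

theorem range_le_range_iff_proj_mul_proj {p h₁ h₂ : ℕ} {H₁ : Matrix (Fin p) (Fin h₁) ℝ}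
    {H₂ : Matrix (Fin p) (Fin h₂) ℝ} (hr₁ : H₁.rank = h₁) (hr₂ : H₂.rank = h₂) :
    LinearMap.range H₁.mulVecLin ≤ LinearMap.range H₂.mulVecLin ↔
      proj H₂ * proj H₁ = proj H₁ := by
  constructor
  · intro hle
    have hH : proj H₂ * H₁ = H₁ := by
      apply mulVec_injective
      funext v
      obtain ⟨w, hw⟩ := hle ⟨v, rfl⟩
      simp only [mulVecLin_apply] at hw
      rw [← mulVec_mulVec, ← hw, mulVec_mulVec, proj_mul_self hr₂]
    rw [proj.eq_1 H₁, ← Matrix.mul_assoc, ← Matrix.mul_assoc, hH]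
  · rintro hP _ ⟨v, rfl⟩
    refine ⟨((H₂ᵀ * H₂)⁻¹ * H₂ᵀ * H₁) *ᵥ v, ?_⟩
    simp only [mulVecLin_apply, mulVec_mulVec]
    congr 1
    calc H₂ * ((H₂ᵀ * H₂)⁻¹ * H₂ᵀ * H₁) = proj H₂ * H₁ := by
          simp only [proj, Matrix.mul_assoc]
      _ = proj H₂ * proj H₁ * H₁ := by rw [Matrix.mul_assoc, proj_mul_self hr₁]
      _ = H₁ := by rw [hP, proj_mul_self hr₁]

theorem trace_conjTranspose_mul_self_sub_proj {p h₁ h₂ : ℕ} {H₁ : Matrix (Fin p) (Fin h₁) ℝ}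
    {H₂ : Matrix (Fin p) (Fin h₂) ℝ} (hr₁ : H₁.rank = h₁) (hr₂ : H₂.rank = h₂) :
    ((proj H₁ - proj H₂ * proj H₁)ᴴ * (proj H₁ - proj H₂ * proj H₁)).trace =
      h₁ - (proj H₁ * proj H₂).trace := by
  have h : (proj H₁ - proj H₂ * proj H₁)ᴴ * (proj H₁ - proj H₂ * proj H₁) =
      proj H₁ - proj H₁ * proj H₂ * proj H₁ := by
    have h₂₂ : proj H₂ * (proj H₂ * proj H₁) = proj H₂ * proj H₁ := by
      rw [← Matrix.mul_assoc, proj_mul_proj hr₂]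
    simp only [conjTranspose_eq_transpose_of_trivial, transpose_sub, transpose_mul,
      transpose_proj, Matrix.sub_mul, Matrix.mul_sub, Matrix.mul_assoc, proj_mul_proj hr₁, h₂₂]
    abel
  rw [h, trace_sub, trace_proj hr₁, trace_mul_comm, ← Matrix.mul_assoc, proj_mul_proj hr₁]

theorem trace_proj_mul_proj_le {p h₁ h₂ : ℕ} {H₁ : Matrix (Fin p) (Fin h₁) ℝ}
    {H₂ : Matrix (Fin p) (Fin h₂) ℝ} (hr₁ : H₁.rank = h₁) (hr₂ : H₂.rank = h₂) :
    (proj H₁ * proj H₂).trace ≤ h₁ := by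
  rw [← sub_nonneg, ← trace_conjTranspose_mul_self_sub_proj hr₁ hr₂]
  exact (posSemidef_conjTranspose_mul_self _).trace_nonneg

theorem trace_proj_mul_proj_eq_iff {p h₁ h₂ : ℕ} {H₁ : Matrix (Fin p) (Fin h₁) ℝ}
    {H₂ : Matrix (Fin p) (Fin h₂) ℝ} (hr₁ : H₁.rank = h₁) (hr₂ : H₂.rank = h₂) :
    (proj H₁ * proj H₂).trace = h₁ ↔
      LinearMap.range H₁.mulVecLin ≤ LinearMap.range H₂.mulVecLin := by
  rw [range_le_range_iff_proj_mul_proj hr₁ hr₂, eq_comm, ← sub_eq_zero,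
    ← trace_conjTranspose_mul_self_sub_proj hr₁ hr₂, trace_conjTranspose_mul_self_eq_zero_iff,
    sub_eq_zero, eq_comm]

theorem trace_proj_mul_proj_eq_min_iff {p h₁ h₂ : ℕ} {H₁ : Matrix (Fin p) (Fin h₁) ℝ}
    {H₂ : Matrix (Fin p) (Fin h₂) ℝ} (hr₁ : H₁.rank = h₁) (hr₂ : H₂.rank = h₂) :
    (proj H₁ * proj H₂).trace = ((min h₁ h₂ : ℕ) : ℝ) ↔
      LinearMap.range H₁.mulVecLin ≤ LinearMap.range H₂.mulVecLin ∨
      LinearMap.range H₂.mulVecLin ≤ LinearMap.range H₁.mulVecLin := by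
  have hle₁ := trace_proj_mul_proj_le hr₁ hr₂
  have hle₂ := trace_proj_mul_proj_le hr₂ hr₁
  rw [← trace_proj_mul_proj_eq_iff hr₁ hr₂, ← trace_proj_mul_proj_eq_iff hr₂ hr₁,
    trace_mul_comm (proj H₂)]
  rw [trace_mul_comm] at hle₂
  rw [Nat.cast_min]
  grind

/-- for full-column-rank `H₁, H₂`, `tr(P₁P₂) = min(h₁,h₂)` iff one column
space is contained in the other; in particular, when `h₁ = h₂` the generalized discrepancy
`D̄ = √(1 − tr(P₁P₂)/max(h₁,h₂))` equals `0` iff one column space contains the other. -/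
theorem gen_discrepancy_eq_zero_iff_nested_spaces
    {p h₁ h₂ : ℕ} (hh₁ : 0 < h₁) (hh₂ : 0 < h₂)
    (H₁ : Matrix (Fin p) (Fin h₁) ℝ) (H₂ : Matrix (Fin p) (Fin h₂) ℝ)
    (hr₁ : H₁.rank = h₁) (hr₂ : H₂.rank = h₂) :
    ((proj H₁ * proj H₂).trace = ((min h₁ h₂ : ℕ) : ℝ) ↔
      LinearMap.range H₁.mulVecLin ≤ LinearMap.range H₂.mulVecLin ∨
      LinearMap.range H₂.mulVecLin ≤ LinearMap.range H₁.mulVecLin) ∧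
    (h₁ = h₂ →
      (Real.sqrt (1 - (proj H₁ * proj H₂).trace / ((max h₁ h₂ : ℕ) : ℝ)) = 0 ↔
        LinearMap.range H₁.mulVecLin ≤ LinearMap.range H₂.mulVecLin ∨
        LinearMap.range H₂.mulVecLin ≤ LinearMap.range H₁.mulVecLin)) := by
  refine ⟨trace_proj_mul_proj_eq_min_iff hr₁ hr₂, ?_⟩
  rintro rfl
  have hpos : (0 : ℝ) < h₁ := Nat.cast_pos.2 hh₁
  rw [← trace_proj_mul_proj_eq_min_iff hr₁ hr₂, max_self, min_self, Real.sqrt_eq_zero',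
    sub_nonpos, one_le_div hpos]
  exact (trace_proj_mul_proj_le hr₁ hr₂).ge_iff_eq
end

section
/- Let Y = A₁XP₁ᵀ + A₂EP₂ᵀ with A₁ ∈ ℝ^{p₁×r₁}, A₂ ∈ ℝ^{p₁×v₁}, P₁ ∈ ℝ^{p₂×r₂}, P₂ ∈ ℝ^{p₂×v₂}, X ∈ ℝ^{r₁×r₂}, E ∈ ℝ^{v₁×v₂}. Let Â₁, B̂₂ ∈ ℝ^{p₁×r₁} and P̂₁, Q̂₂ ∈ ℝ^{p₂×r₂} be matrices such that B̂₂ᵀÂ₁ and P̂₁ᵀQ̂₂ are invertible, and define X̂ = (B̂₂ᵀÂ₁)⁻¹ B̂₂ᵀ Y Q̂₂ (P̂₁ᵀQ̂₂)⁻¹. Then the exact decomposition Â₁X̂P̂₁ᵀ = Â₁XP̂₁ᵀ + Â₁X(P₁ − P̂₁)ᵀQ̂₂(P̂₁ᵀQ̂₂)⁻¹P̂₁ᵀ + Â₁(B̂₂ᵀÂ₁)⁻¹B̂₂ᵀ(A₁ − Â₁)XP₁ᵀQ̂₂(P̂₁ᵀQ̂₂)⁻¹P̂₁ᵀ + Â₁(B̂₂ᵀÂ₁)⁻¹B̂₂ᵀA₂EP₂ᵀQ̂₂(P̂₁ᵀQ̂₂)⁻¹P̂₁ᵀ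 holds. -/
open Matrix

/-- exact decomposition `Â₁X̂P̂₁ᵀ = Π₁ + Π₂ + Π₃ + Π₄` of the recovered
common-factor component, where
`X̂ = (B̂₂ᵀÂ₁)⁻¹ B̂₂ᵀ Y Q̂₂ (P̂₁ᵀQ̂₂)⁻¹` and `Y = A₁XP₁ᵀ + A₂EP₂ᵀ`. -/
theorem recovered_factor_decomposition
    {p₁ p₂ r₁ r₂ v₁ v₂ : ℕ}
    (A₁ : Matrix (Fin p₁) (Fin r₁) ℝ) (A₂ : Matrix (Fin p₁) (Fin v₁) ℝ)
    (P₁ : Matrix (Fin p₂) (Fin r₂) ℝ) (P₂ : Matrix (Fin p₂) (Fin v₂) ℝ)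
    (X : Matrix (Fin r₁) (Fin r₂) ℝ) (E : Matrix (Fin v₁) (Fin v₂) ℝ)
    (Y : Matrix (Fin p₁) (Fin p₂) ℝ)
    (hY : Y = A₁ * X * P₁ᵀ + A₂ * E * P₂ᵀ)
    (Ahat₁ B₂ : Matrix (Fin p₁) (Fin r₁) ℝ)
    (Phat₁ Q₂ : Matrix (Fin p₂) (Fin r₂) ℝ)
    (h₁ : IsUnit (B₂ᵀ * Ahat₁)) (h₂ : IsUnit (Phat₁ᵀ * Q₂))
    (Xhat : Matrix (Fin r₁) (Fin r₂) ℝ)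
    (hX : Xhat = (B₂ᵀ * Ahat₁)⁻¹ * (B₂ᵀ * Y * Q₂) * (Phat₁ᵀ * Q₂)⁻¹) :
    Ahat₁ * Xhat * Phat₁ᵀ =
      Ahat₁ * X * Phat₁ᵀ
      + Ahat₁ * X * (P₁ - Phat₁)ᵀ * Q₂ * (Phat₁ᵀ * Q₂)⁻¹ * Phat₁ᵀ
      + Ahat₁ * (B₂ᵀ * Ahat₁)⁻¹ * (B₂ᵀ * (A₁ - Ahat₁)) * X * P₁ᵀ * Q₂ *
          (Phat₁ᵀ * Q₂)⁻¹ * Phat₁ᵀ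
      + Ahat₁ * (B₂ᵀ * Ahat₁)⁻¹ * B₂ᵀ * A₂ * E * P₂ᵀ * Q₂ *
          (Phat₁ᵀ * Q₂)⁻¹ * Phat₁ᵀ := by
  have hM : (B₂ᵀ * Ahat₁)⁻¹ * (B₂ᵀ * Ahat₁) = 1 :=
    Matrix.nonsing_inv_mul _ ((Matrix.isUnit_iff_isUnit_det _).mp h₁)
  have hN : (Phat₁ᵀ * Q₂) * (Phat₁ᵀ * Q₂)⁻¹ = 1 :=
    Matrix.mul_nonsing_inv _ ((Matrix.isUnit_iff_isUnit_det _).mp h₂)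
  subst hX hY
  generalize (B₂ᵀ * Ahat₁)⁻¹ = M at hM ⊢
  generalize (Phat₁ᵀ * Q₂)⁻¹ = N at hN ⊢
  have hM' : ∀ Z : Matrix (Fin r₁) (Fin p₂) ℝ, M * (B₂ᵀ * (Ahat₁ * Z)) = Z := fun Z => by
    rw [← Matrix.mul_assoc B₂ᵀ, ← Matrix.mul_assoc, hM, Matrix.one_mul]
  have hN' : ∀ Z : Matrix (Fin r₂) (Fin p₂) ℝ, Phat₁ᵀ * (Q₂ * (N * Z)) = Z := fun Z => by
    rw [← Matrix.mul_assoc Q₂, ← Matrix.mul_assoc, ← Matrix.mul_assoc Phat₁ᵀ, hN,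
      Matrix.one_mul]
  simp only [Matrix.transpose_sub, Matrix.mul_add, Matrix.add_mul, Matrix.mul_sub,
    Matrix.sub_mul, Matrix.mul_assoc, hM', hN']
  abel
end
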